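/- arXiv:1103.5285 — 7 statements merged into one kernel-verified Lean document; each statement's English description precedes it below -/
import Mathlib

section
/- Let X be a partially ordered set such that every pair of elements x, y in X has a lower bound and an upper bound, and let d be a metric on X such that (X, d) is a complete metric space. Let T : X → X be a continuous map that is monotone (i.e., either order-preserving or order-reversing) and suppose there exists a constant c with 0 < c < 1 such that d(T(x), T(y)) ≤ c·d(x, y) for all x, y with x ≥ y. If there exists x₀ ∈ X with x₀ ≤ T(x₀) or x₀ ≥ T(x₀), then T has a unique fixed point x̄, and moreover for every x ∈ X the sequence of iterates Tⁿ(x) converges to x̄. -/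
/-- **Ran–Reurings fixed point theorem.**
Let `X` be a partially ordered set such that every pair of elements has a lower bound
and an upper bound, with a metric making `X` a complete metric space. If `T : X → X`
is continuous, monotone (order-preserving or order-reversing), satisfies
`d(T x, T y) ≤ c · d(x, y)` for all `x ≥ y` with `0 < c < 1`, and there exists `x₀`
with `x₀ ≤ T x₀` or `x₀ ≥ T x₀`, then `T` has a unique fixed point `x̄` and the
iterates `Tⁿ x` converge to `x̄` for every `x`. -/
theorem ran_reurings_fixed_point
    {X : Type*} [PartialOrder X] [MetricSpace X] [CompleteSpace X]
    (hbounds : ∀ x y : X, (∃ l, l ≤ x ∧ l ≤ y) ∧ (∃ u, x ≤ u ∧ y ≤ u))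
    (T : X → X) (hT : Continuous T)
    (hmono : Monotone T ∨ Antitone T)
    (c : ℝ) (hc0 : 0 < c) (hc1 : c < 1)
    (hcontr : ∀ x y : X, y ≤ x → dist (T x) (T y) ≤ c * dist x y)
    (x₀ : X) (hx₀ : x₀ ≤ T x₀ ∨ T x₀ ≤ x₀) :
    ∃ xbar : X, T xbar = xbar ∧ (∀ y : X, T y = y → y = xbar) ∧
      ∀ x : X, Filter.Tendsto (fun n => T^[n] x) Filter.atTop (nhds xbar) := by
  have hcomp : ∀ x y : X, (x ≤ y ∨ y ≤ x) → (T x ≤ T y ∨ T y ≤ T x) := by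
    intro x y h
    rcases hmono with hm | hm <;> rcases h with h | h <;> have := hm h <;> tauto
  have hd : ∀ x y : X, (x ≤ y ∨ y ≤ x) → dist (T x) (T y) ≤ c * dist x y := by
    intro x y h
    rcases h with h | h
    · rw [dist_comm (T x), dist_comm x]
      exact hcontr y x h
    · exact hcontr x y h
  have hiter : ∀ (n : ℕ) (x y : X), (x ≤ y ∨ y ≤ x) →
      dist (T^[n] x) (T^[n] y) ≤ dist x y * c ^ n := by
    intro n
    induction n with
    | zero => intro x y _; simp
    | succ n ih =>
      intro x y h
      rw [Function.iterate_succ_apply, Function.iterate_succ_apply]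
      calc dist (T^[n] (T x)) (T^[n] (T y)) ≤ dist (T x) (T y) * c ^ n := ih _ _ (hcomp x y h)
        _ ≤ (c * dist x y) * c ^ n :=
          mul_le_mul_of_nonneg_right (hd x y h) (pow_nonneg hc0.le n)
        _ = dist x y * c ^ (n + 1) := by ring
  have hall : ∀ x y : X, ∃ C : ℝ, ∀ n : ℕ, dist (T^[n] x) (T^[n] y) ≤ C * c ^ n := by
    intro x y
    obtain ⟨u, hxu, hyu⟩ := (hbounds x y).2
    refine ⟨dist x u + dist u y, fun n => ?_⟩
    have h1 := hiter n x u (Or.inl hxu)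
    have h2 := hiter n u y (Or.inr hyu)
    have h3 := dist_triangle (T^[n] x) (T^[n] u) (T^[n] y)
    linarith
  have hpow : Filter.Tendsto (fun n : ℕ => c ^ n) Filter.atTop (nhds 0) :=
    tendsto_pow_atTop_nhds_zero_of_lt_one hc0.le hc1
  have hCau : CauchySeq (fun n => T^[n] x₀) := by
    refine cauchySeq_of_le_geometric c (dist x₀ (T x₀)) hc1 (fun n => ?_)
    rw [Function.iterate_succ_apply]
    exact hiter n x₀ (T x₀) hx₀
  obtain ⟨p, hp⟩ := cauchySeq_tendsto_of_complete hCau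
  have hfix : T p = p := isFixedPt_of_tendsto_iterate hp hT.continuousAt
  have hconv : ∀ x : X, Filter.Tendsto (fun n => T^[n] x) Filter.atTop (nhds p) := by
    intro x
    obtain ⟨C, hC⟩ := hall x p
    rw [tendsto_iff_dist_tendsto_zero]
    refine squeeze_zero (fun _ => dist_nonneg) (fun n => ?_) (by simpa using hpow.const_mul C)
    have h := hC n
    rwa [Function.iterate_fixed hfix n] at h
  refine ⟨p, hfix, fun y hy => ?_, hconv⟩
  have h := hconv y
  simp only [Function.iterate_fixed hy] at h
  exact tendsto_nhds_unique tendsto_const_nhds h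
end

section
/- Let (X, ≤) be a partially ordered set and d a metric on X such that (X, d) is a complete metric space. Let F : X × X → X be a continuous mapping having the mixed monotone property on X, and assume there exists a constant k ∈ [0, 1) such that d(F(x,y), F(u,v)) ≤ (k/2)·[d(x,u) + d(y,v)] for all x ≥ u and y ≤ v. If there exist x₀, y₀ ∈ X such that x₀ ≤ F(x₀, y₀) and y₀ ≥ F(y₀, x₀), then there exist x, y ∈ X such that x = F(x, y) and y = F(y, x). -/
/-- `F : X → X → X` has the mixed monotone property: it is monotone nondecreasing
in its first argument and monotone nonincreasing in its second argument. -/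
def MixedMonotone {X : Type*} [PartialOrder X] (F : X → X → X) : Prop :=
  (∀ y : X, Monotone fun x => F x y) ∧ (∀ x : X, Antitone fun y => F x y)

/-- **Bhaskar–Lakshmikantham coupled fixed point theorem.**
Let `(X, ≤)` be a partially ordered set with a metric making it a complete metric
space, `F : X × X → X` continuous and mixed monotone, satisfying
`d(F(x,y), F(u,v)) ≤ (k/2)·[d(x,u) + d(y,v)]` for all `x ≥ u`, `y ≤ v`, with
`k ∈ [0,1)`. If there are `x₀, y₀` with `x₀ ≤ F(x₀,y₀)` and `y₀ ≥ F(y₀,x₀)`,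
then `F` has a coupled fixed point. -/
theorem bhaskar_lakshmikantham_coupled_fixed_point
    {X : Type*} [PartialOrder X] [MetricSpace X] [CompleteSpace X]
    (F : X → X → X) (hcont : Continuous fun p : X × X => F p.1 p.2)
    (hmm : MixedMonotone F)
    (k : ℝ) (hk0 : 0 ≤ k) (hk1 : k < 1)
    (hcontr : ∀ x y u v : X, u ≤ x → y ≤ v →
      dist (F x y) (F u v) ≤ k / 2 * (dist x u + dist y v))
    (x₀ y₀ : X) (hx₀ : x₀ ≤ F x₀ y₀) (hy₀ : F y₀ x₀ ≤ y₀) :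
    ∃ x y : X, F x y = x ∧ F y x = y := by
  obtain ⟨hm1, hm2⟩ := hmm
  let G : X × X → X × X := fun p => (F p.1 p.2, F p.2 p.1)
  have hG : Continuous G := hcont.prodMk (hcont.comp continuous_swap)
  let s : ℕ → X × X := fun n => G^[n] (x₀, y₀)
  have hs : ∀ n, s (n + 1) = G (s n) := fun n => Function.iterate_succ_apply' G n _
  have hord : ∀ n, (s n).1 ≤ (s (n + 1)).1 ∧ (s (n + 1)).2 ≤ (s n).2 := by
    intro n
    induction n with
    | zero => exact ⟨hx₀, hy₀⟩
    | succ n ih =>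
      rw [hs (n + 1)]
      constructor
      · have h : F (s n).1 (s n).2 ≤ F (s (n + 1)).1 (s (n + 1)).2 :=
          (hm1 _ ih.1).trans (hm2 _ ih.2)
        have e : (s (n + 1)).1 = F (s n).1 (s n).2 := by rw [hs n]
        exact e.trans_le h
      · have h : F (s (n + 1)).2 (s (n + 1)).1 ≤ F (s n).2 (s n).1 :=
          (hm1 _ ih.2).trans (hm2 _ ih.1)
        have e : (s (n + 1)).2 = F (s n).2 (s n).1 := by rw [hs n]
        exact h.trans_eq e.symm
  have hstep : ∀ p q : X × X, p.1 ≤ q.1 → q.2 ≤ p.2 → dist (G p) (G q) ≤ k * dist p q := by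
    intro p q h1 h2
    have a1 : dist p.1 q.1 ≤ dist p q := le_max_left _ _
    have a2 : dist p.2 q.2 ≤ dist p q := le_max_right _ _
    have b1 := hcontr q.1 q.2 p.1 p.2 h1 h2
    have b2 := hcontr p.2 p.1 q.2 q.1 h2 h1
    rw [dist_comm (F q.1 q.2), dist_comm q.1, dist_comm q.2] at b1
    rw [Prod.dist_eq (x := G p)]
    apply max_le
    · change dist (F p.1 p.2) (F q.1 q.2) ≤ _
      nlinarith
    · change dist (F p.2 p.1) (F q.2 q.1) ≤ _
      nlinarith
  have hd : ∀ n, dist (s n) (s (n + 1)) ≤ dist (s 0) (s 1) * k ^ n := by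
    intro n
    induction n with
    | zero => simp
    | succ n ih =>
      have h := hstep (s n) (s (n + 1)) (hord n).1 (hord n).2
      rw [← hs, ← hs] at h
      calc _ ≤ _ := h
        _ ≤ k * (dist (s 0) (s 1) * k ^ n) := mul_le_mul_of_nonneg_left ih hk0
        _ = _ := by ring
  obtain ⟨p, hp⟩ := cauchySeq_tendsto_of_complete (cauchySeq_of_le_geometric k _ hk1 hd)
  have hfix : G p = p := isFixedPt_of_tendsto_iterate hp hG.continuousAt
  exact ⟨p.1, p.2, congrArg Prod.fst hfix, congrArg Prod.snd hfix⟩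
end

section
/- Let (X, ≤) be a partially ordered set and d a metric on X such that (X, d) is a complete metric space. Let F : X × X → X be a mixed monotone mapping such that there exists k ∈ [0, 1) with d(F(x,y), F(u,v)) + d(F(y,x), F(v,u)) ≤ k·[d(x,u) + d(y,v)] for all x ≥ u, y ≤ v. Suppose x₀, y₀ ∈ X satisfy x₀ ≤ F(x₀, y₀) and y₀ ≥ F(y₀, x₀), and define x_{n+1} = F(x_n, y_n), y_{n+1} = F(y_n, x_n). Then d(x_{n+1}, x_n) + d(y_{n+1}, y_n) ≤ kⁿ·[d(x₁, x₀) + d(y₁, y₀)] for all n ≥ 0, and the sequences (x_n) and (y_n) are Cauchy sequences in X. -/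
/-- Let `(X, d)` be a complete partially ordered metric space, `F` mixed monotone
with `d(F(x,y), F(u,v)) + d(F(y,x), F(v,u)) ≤ k·[d(x,u) + d(y,v)]` for all `x ≥ u`,
`y ≤ v`, `k ∈ [0,1)`, and suppose `x₀ ≤ F(x₀,y₀)`, `y₀ ≥ F(y₀,x₀)`. Define
`x_{n+1} = F(x_n, y_n)`, `y_{n+1} = F(y_n, x_n)`. Then
`d(x_{n+1}, x_n) + d(y_{n+1}, y_n) ≤ kⁿ·[d(x₁,x₀) + d(y₁,y₀)]` for all `n`, and the
sequences `(x_n)` and `(y_n)` are Cauchy. -/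
theorem coupled_iterates_estimate_and_cauchy
    {X : Type*} [PartialOrder X] [MetricSpace X] [CompleteSpace X]
    (F : X → X → X) (hmm : MixedMonotone F)
    (k : ℝ) (hk0 : 0 ≤ k) (hk1 : k < 1)
    (hcontr : ∀ x y u v : X, u ≤ x → y ≤ v →
      dist (F x y) (F u v) + dist (F y x) (F v u) ≤ k * (dist x u + dist y v))
    (x₀ y₀ : X) (hx₀ : x₀ ≤ F x₀ y₀) (hy₀ : F y₀ x₀ ≤ y₀)
    (x y : ℕ → X) (hx0 : x 0 = x₀) (hy0 : y 0 = y₀)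
    (hx : ∀ n : ℕ, x (n + 1) = F (x n) (y n))
    (hy : ∀ n : ℕ, y (n + 1) = F (y n) (x n)) :
    (∀ n : ℕ, dist (x (n + 1)) (x n) + dist (y (n + 1)) (y n) ≤
      k ^ n * (dist (x 1) (x 0) + dist (y 1) (y 0))) ∧
    CauchySeq x ∧ CauchySeq y := by
  have hmono : ∀ n, x n ≤ x (n + 1) ∧ y (n + 1) ≤ y n := by
    intro n
    induction n with
    | zero =>
      rw [hx 0, hy 0, hx0, hy0]
      exact ⟨hx₀, hy₀⟩
    | succ n ih =>
      obtain ⟨h1, h2⟩ := ih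
      rw [hx (n + 1), hy (n + 1)]
      constructor
      · calc x (n + 1) = F (x n) (y n) := hx n
          _ ≤ F (x (n + 1)) (y n) := hmm.1 (y n) h1
          _ ≤ F (x (n + 1)) (y (n + 1)) := hmm.2 (x (n + 1)) h2
      · calc F (y (n + 1)) (x (n + 1)) ≤ F (y n) (x (n + 1)) := hmm.1 (x (n + 1)) h2
          _ ≤ F (y n) (x n) := hmm.2 (y n) h1
          _ = y (n + 1) := (hy n).symm
  have hest : ∀ n : ℕ, dist (x (n + 1)) (x n) + dist (y (n + 1)) (y n) ≤
      k ^ n * (dist (x 1) (x 0) + dist (y 1) (y 0)) := by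
    intro n
    induction n with
    | zero => simp
    | succ n ih =>
      have h := hcontr _ _ _ _ (hmono n).1 (hmono n).2
      rw [← hx, ← hy, ← hx, ← hy] at h
      calc _ ≤ _ := h
        _ ≤ k * (k ^ n * (dist (x 1) (x 0) + dist (y 1) (y 0))) :=
          mul_le_mul_of_nonneg_left ih hk0
        _ = _ := by ring
  refine ⟨hest, ?_, ?_⟩
  · refine cauchySeq_of_le_geometric k (dist (x 1) (x 0) + dist (y 1) (y 0)) hk1 fun n => ?_
    have h := hest n
    have h2 : 0 ≤ dist (y (n + 1)) (y n) := dist_nonneg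
    rw [dist_comm (x n)]
    linarith
  · refine cauchySeq_of_le_geometric k (dist (x 1) (x 0) + dist (y 1) (y 0)) hk1 fun n => ?_
    have h := hest n
    have h2 : 0 ≤ dist (x (n + 1)) (x n) := dist_nonneg
    rw [dist_comm (y n)]
    linarith
end

section
/- Let (X, ≤) be a partially ordered set and d a metric on X such that (X, d) is a complete metric space. Let F : X × X → X be a mixed monotone mapping such that there exists k ∈ [0, 1) with d(F(x,y), F(u,v)) + d(F(y,x), F(v,u)) ≤ k·[d(x,u) + d(y,v)] for all x ≥ u, y ≤ v, and suppose there exist x₀, y₀ ∈ X with x₀ ≤ F(x₀, y₀) and y₀ ≥ F(y₀, x₀). Assume additionally that for every pair Y = (x,y) and Ȳ = (x̄, ȳ) in X² there exists Z = (z₁, z₂) ∈ X² that is comparable (with respect to the product order) to both Y and Ȳ. Then the coupled fixed point of F is unique: if (x̄, ȳ) and (x*, y*) both satisfy x̄ = F(x̄, ȳ), ȳ = F(ȳ, x̄) and x* = F(x*, y*), y* = F(y*, x*), then x̄ = x* and ȳ = y*. -/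
/-- Two pairs are comparable with respect to the product order on `X²` given by
`(u,v) ≤ (x,y) ↔ u ≤ x ∧ y ≤ v`. -/
def ProdComparable {X : Type*} [PartialOrder X] (Y V : X × X) : Prop :=
  (Y.1 ≤ V.1 ∧ V.2 ≤ Y.2) ∨ (V.1 ≤ Y.1 ∧ Y.2 ≤ V.2)

/-- **Uniqueness of the coupled fixed point (Theorem 4).** Under the hypotheses of
Berinde's coupled fixed point theorem, if in addition every pair of elements of `X²`
has an element of `X²` comparable (in the product order) to both, then the coupled
fixed point of `F` is unique. -/
theorem coupled_fixed_point_unique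
    {X : Type*} [PartialOrder X] [MetricSpace X] [CompleteSpace X]
    (F : X → X → X) (hmm : MixedMonotone F)
    (k : ℝ) (hk0 : 0 ≤ k) (hk1 : k < 1)
    (hcontr : ∀ x y u v : X, u ≤ x → y ≤ v →
      dist (F x y) (F u v) + dist (F y x) (F v u) ≤ k * (dist x u + dist y v))
    (x₀ y₀ : X) (hx₀ : x₀ ≤ F x₀ y₀) (hy₀ : F y₀ x₀ ≤ y₀)
    (hcomp : ∀ Y Ybar : X × X, ∃ Z : X × X, ProdComparable Z Y ∧ ProdComparable Z Ybar) :
    ∀ xbar ybar xstar ystar : X,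
      F xbar ybar = xbar → F ybar xbar = ybar →
      F xstar ystar = xstar → F ystar xstar = ystar →
      xbar = xstar ∧ ybar = ystar := by
  intro a b c e ha hb hc he
  obtain ⟨Z, hZ1, hZ2⟩ := hcomp (a, b) (c, e)
  let T : X × X → X × X := fun p => (F p.1 p.2, F p.2 p.1)
  have key : ∀ x y : X, F x y = x → F y x = y → ProdComparable Z (x, y) → ∀ n : ℕ,
      ProdComparable (T^[n] Z) (x, y) ∧
      dist (T^[n] Z).1 x + dist (T^[n] Z).2 y ≤ k ^ n * (dist Z.1 x + dist Z.2 y) := by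
    intro x y hx hy hZ n
    induction n with
    | zero => exact ⟨hZ, by simp⟩
    | succ n ih =>
      rw [Function.iterate_succ_apply']
      obtain ⟨h1, h2⟩ := ih
      generalize T^[n] Z = W at h1 h2
      obtain ⟨u, v⟩ := W
      have h3 : k * (dist u x + dist v y) ≤ k ^ (n + 1) * (dist Z.1 x + dist Z.2 y) := by
        have := mul_le_mul_of_nonneg_left h2 hk0
        rw [pow_succ]
        linarith
      rcases h1 with ⟨p, q⟩ | ⟨p, q⟩
      · simp only at p q
        have m1 : F u v ≤ F x y := (hmm.1 v p).trans (hmm.2 x q)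
        have m2 : F y x ≤ F v u := (hmm.1 x q).trans (hmm.2 v p)
        have := hcontr x y u v p q
        rw [hx, hy] at this
        rw [hx] at m1
        rw [hy] at m2
        refine ⟨Or.inl ⟨m1, m2⟩, ?_⟩
        change dist (F u v) x + dist (F v u) y ≤ _
        rw [dist_comm x (F u v), dist_comm y (F v u), dist_comm x u, dist_comm y v] at this
        linarith
      · simp only at p q
        have m1 : F x y ≤ F u v := (hmm.1 y p).trans (hmm.2 u q)
        have m2 : F v u ≤ F y x := (hmm.1 u q).trans (hmm.2 y p)
        have := hcontr u v x y p q
        rw [hx, hy] at this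
        rw [hx] at m1
        rw [hy] at m2
        refine ⟨Or.inr ⟨m1, m2⟩, ?_⟩
        change dist (F u v) x + dist (F v u) y ≤ _
        linarith
  have hpow := tendsto_pow_atTop_nhds_zero_of_lt_one hk0 hk1
  have hlim := hpow.mul_const ((dist Z.1 a + dist Z.2 b) + (dist Z.1 c + dist Z.2 e))
  rw [zero_mul] at hlim
  have hle : dist a c + dist b e ≤ 0 := by
    refine ge_of_tendsto' hlim fun n => ?_
    have h1 := (key a b ha hb hZ1 n).2
    have h2 := (key c e hc he hZ2 n).2
    have h3 := dist_triangle_left a c (T^[n] Z).1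
    have h4 := dist_triangle_left b e (T^[n] Z).2
    rw [mul_add]
    linarith
  have h1 := dist_nonneg (x := a) (y := c)
  have h2 := dist_nonneg (x := b) (y := e)
  exact ⟨dist_le_zero.1 (by linarith), dist_le_zero.1 (by linarith)⟩
end

section
/- Let (X, ≤) be a partially ordered set and d a metric on X such that (X, d) is a complete metric space. Let F : X × X → X be a mixed monotone mapping such that there exists k ∈ [0, 1) with d(F(x,y), F(u,v)) + d(F(y,x), F(v,u)) ≤ k·[d(x,u) + d(y,v)] for all x ≥ u, y ≤ v, and suppose there exist x₀, y₀ ∈ X with x₀ ≤ F(x₀, y₀) and y₀ ≥ F(y₀, x₀). Assume additionally that every pair of elements of X has an upper bound or a lower bound in X. Then every coupled fixed point (x̄, ȳ) of F satisfies x̄ = ȳ; in particular F has a fixed point: F(x̄, x̄) = x̄. -/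
/-- Iterates of the coupled map contract along comparable pairs. -/
theorem coupled_iterate_bound {X : Type*} [PartialOrder X] [MetricSpace X]
    (F : X → X → X) (hmm : MixedMonotone F) (k : ℝ) (hk0 : 0 ≤ k)
    (hcontr : ∀ x y u v : X, u ≤ x → y ≤ v →
      dist (F x y) (F u v) + dist (F y x) (F v u) ≤ k * (dist x u + dist y v))
    (T : X × X → X × X) (hT : T = fun p => (F p.1 p.2, F p.2 p.1)) (n : ℕ) :
    ∀ p q : X × X, q.1 ≤ p.1 → p.2 ≤ q.2 →
      dist (T^[n] p).1 (T^[n] q).1 ≤ k ^ n * (dist p.1 q.1 + dist p.2 q.2) := by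
  induction n with
  | zero =>
    intro p q _ _
    simp
  | succ n ih =>
    intro p q h1 h2
    rw [Function.iterate_succ_apply, Function.iterate_succ_apply]
    have a1 : (T q).1 ≤ (T p).1 := by
      subst hT
      exact (hmm.1 q.2 h1).trans (hmm.2 p.1 h2)
    have a2 : (T p).2 ≤ (T q).2 := by
      subst hT
      exact (hmm.1 p.1 h2).trans (hmm.2 q.2 h1)
    refine (ih _ _ a1 a2).trans ?_
    have h3 : dist (T p).1 (T q).1 + dist (T p).2 (T q).2
        ≤ k * (dist p.1 q.1 + dist p.2 q.2) := by
      subst hT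
      exact hcontr _ _ _ _ h1 h2
    calc _ ≤ k ^ n * (k * (dist p.1 q.1 + dist p.2 q.2)) := by gcongr
      _ = _ := by ring

/-- **Theorem 5.** Under the hypotheses of Berinde's coupled fixed point theorem,
if in addition every pair of elements of `X` has an upper bound or a lower bound in
`X`, then every coupled fixed point `(x̄, ȳ)` of `F` satisfies `x̄ = ȳ`; in
particular `F` has a fixed point: `F(x̄, x̄) = x̄`. -/
theorem coupled_fixed_point_components_equal
    {X : Type*} [PartialOrder X] [MetricSpace X] [CompleteSpace X]
    (F : X → X → X) (hmm : MixedMonotone F)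
    (k : ℝ) (hk0 : 0 ≤ k) (hk1 : k < 1)
    (hcontr : ∀ x y u v : X, u ≤ x → y ≤ v →
      dist (F x y) (F u v) + dist (F y x) (F v u) ≤ k * (dist x u + dist y v))
    (x₀ y₀ : X) (hx₀ : x₀ ≤ F x₀ y₀) (hy₀ : F y₀ x₀ ≤ y₀)
    (hbound : ∀ a b : X, (∃ c, a ≤ c ∧ b ≤ c) ∨ (∃ c, c ≤ a ∧ c ≤ b)) :
    ∀ xbar ybar : X, F xbar ybar = xbar → F ybar xbar = ybar →
      xbar = ybar ∧ F xbar xbar = xbar := by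
  intro x y hx hy
  obtain ⟨T, hT⟩ : ∃ T : X × X → X × X, T = fun p => (F p.1 p.2, F p.2 p.1) := ⟨_, rfl⟩
  have key := coupled_iterate_bound F hmm k hk0 hcontr T hT
  have f1 : ∀ n, T^[n] (x, y) = (x, y) := fun n =>
    Function.iterate_fixed (by simp [hT, hx, hy]) n
  have f2 : ∀ n, T^[n] (y, x) = (y, x) := fun n =>
    Function.iterate_fixed (by simp [hT, hx, hy]) n
  have hC : ∃ C : ℝ, ∀ n : ℕ, dist x y ≤ k ^ n * C := by
    rcases hbound x y with ⟨c, h1, h2⟩ | ⟨c, h1, h2⟩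
    · refine ⟨(dist x x + dist y c) + (dist c x + dist x c) + (dist c y + dist x x), fun n => ?_⟩
      have e1 := key n (x, y) (x, c) le_rfl h2
      have e2 := key n (c, x) (x, c) h1 h1
      have e3 := key n (c, x) (y, x) h2 le_rfl
      rw [f1] at e1
      rw [f2] at e3
      have t := dist_triangle4 x (T^[n] (x, c)).1 (T^[n] (c, x)).1 y
      rw [dist_comm (T^[n] (x, c)).1] at t
      simp only at e1 e2 e3
      linarith
    · refine ⟨(dist x x + dist c y) + (dist x c + dist c x) + (dist y c + dist x x), fun n => ?_⟩
      have e1 := key n (x, c) (x, y) le_rfl h2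
      have e2 := key n (x, c) (c, x) h1 h1
      have e3 := key n (y, x) (c, x) h2 le_rfl
      rw [f1] at e1
      rw [f2] at e3
      have t := dist_triangle4 x (T^[n] (x, c)).1 (T^[n] (c, x)).1 y
      rw [dist_comm x (T^[n] (x, c)).1, dist_comm (T^[n] (c, x)).1 y] at t
      simp only at e1 e2 e3
      linarith
  obtain ⟨C, hC⟩ := hC
  have hl : Filter.Tendsto (fun n : ℕ => k ^ n * C) Filter.atTop (nhds 0) := by
    simpa using (tendsto_pow_atTop_nhds_zero_of_lt_one hk0 hk1).mul_const C
  have hxy : x = y := dist_le_zero.mp (ge_of_tendsto' hl hC)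
  subst hxy
  exact ⟨rfl, hx⟩
end

section
/- Let (X, ≤) be a partially ordered set and d a metric on X such that (X, d) is a complete metric space. Let F : X × X → X be a mixed monotone mapping such that there exists k ∈ [0, 1) with d(F(x,y), F(u,v)) + d(F(y,x), F(v,u)) ≤ k·[d(x,u) + d(y,v)] for all x ≥ u, y ≤ v. Suppose there exist x₀, y₀ ∈ X with x₀ ≤ F(x₀, y₀) and y₀ ≥ F(y₀, x₀), and suppose additionally that x₀ and y₀ are comparable (x₀ ≤ y₀ or x₀ ≥ y₀). Then the coupled fixed point (x̄, ȳ) of F obtained as the limit of the iterates x_{n+1} = F(x_n, y_n), y_{n+1} = F(y_n, x_n) satisfies x̄ = ȳ, that is, F has a fixed point: F(x̄, x̄) = x̄. -/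
/-- **Theorem 6.** Under the hypotheses of Berinde's coupled fixed point theorem,
suppose additionally that `x₀` and `y₀` are comparable. Then the coupled fixed
point `(x̄, ȳ)` of `F` obtained as the limit of the iterates
`x_{n+1} = F(x_n, y_n)`, `y_{n+1} = F(y_n, x_n)` satisfies `x̄ = ȳ`, that is, `F`
has a fixed point: `F(x̄, x̄) = x̄`. -/
theorem coupled_fixed_point_components_equal_of_comparable_start
    {X : Type*} [PartialOrder X] [MetricSpace X] [CompleteSpace X]
    (F : X → X → X) (hmm : MixedMonotone F)
    (k : ℝ) (hk0 : 0 ≤ k) (hk1 : k < 1)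
    (hcontr : ∀ x y u v : X, u ≤ x → y ≤ v →
      dist (F x y) (F u v) + dist (F y x) (F v u) ≤ k * (dist x u + dist y v))
    (x₀ y₀ : X) (hx₀ : x₀ ≤ F x₀ y₀) (hy₀ : F y₀ x₀ ≤ y₀)
    (hcomp : x₀ ≤ y₀ ∨ y₀ ≤ x₀)
    (x y : ℕ → X) (hx0 : x 0 = x₀) (hy0 : y 0 = y₀)
    (hx : ∀ n : ℕ, x (n + 1) = F (x n) (y n))
    (hy : ∀ n : ℕ, y (n + 1) = F (y n) (x n))
    (xbar ybar : X)
    (hxlim : Filter.Tendsto x Filter.atTop (nhds xbar))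
    (hylim : Filter.Tendsto y Filter.atTop (nhds ybar))
    (hxfix : F xbar ybar = xbar) (hyfix : F ybar xbar = ybar) :
    xbar = ybar ∧ F xbar xbar = xbar := by
  have hcmp : ∀ n, x n ≤ y n ∨ y n ≤ x n := by
    intro n
    induction n with
    | zero => rw [hx0, hy0]; exact hcomp
    | succ n ih =>
      rw [hx, hy]
      rcases ih with h | h
      · exact Or.inl ((hmm.1 (y n) h).trans (hmm.2 (y n) h))
      · exact Or.inr ((hmm.1 (x n) h).trans (hmm.2 (x n) h))
  have hstep : ∀ n, dist (x (n + 1)) (y (n + 1)) ≤ k * dist (x n) (y n) := by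
    intro n
    rw [hx, hy]
    rcases hcmp n with h | h
    · have := hcontr (y n) (x n) (x n) (y n) h h
      rw [dist_comm (F (y n) (x n)), dist_comm (y n)] at this
      linarith
    · have := hcontr (x n) (y n) (y n) (x n) h h
      rw [dist_comm (F (y n) (x n)), dist_comm (y n)] at this
      linarith
  have hlim := hxlim.dist hylim
  have hlim1 := (Filter.tendsto_add_atTop_iff_nat 1).2 hlim
  have hle : dist xbar ybar ≤ k * dist xbar ybar :=
    le_of_tendsto_of_tendsto' hlim1 (hlim.const_mul k) hstep
  have h0 : dist xbar ybar = 0 := by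
    have := dist_nonneg (x := xbar) (y := ybar)
    nlinarith
  have heq : xbar = ybar := dist_eq_zero.1 h0
  refine ⟨heq, ?_⟩
  subst heq
  exact hxfix
end

section
/- Let (X, ≤) be a partially ordered set and d a metric on X such that (X, d) is a complete metric space. Let F : X × X → X be a mixed monotone mapping such that there exists k ∈ [0, 1) with d(F(x,y), F(u,v)) + d(F(y,x), F(v,u)) ≤ k·[d(x,u) + d(y,v)] for all x ≥ u, y ≤ v, and suppose there exist x₀, y₀ ∈ X with x₀ ≤ F(x₀, y₀) and y₀ ≥ F(y₀, x₀). Define x_{n+1} = F(x_n, y_n) and y_{n+1} = F(y_n, x_n), and let (x̄, ȳ) be the coupled fixed point of F obtained as the limit of (x_n, y_n). Then the following a priori error estimate holds for all n ≥ 0: d(x_n, x̄) + d(y_n, ȳ) ≤ (kⁿ/(1−k))·[d(x₁, x₀) + d(y₁, y₀)]. -/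
/-- **A priori error estimate.** Under the hypotheses of Berinde's coupled fixed
point theorem, for the iterates `x_{n+1} = F(x_n, y_n)`, `y_{n+1} = F(y_n, x_n)`
converging to the coupled fixed point `(x̄, ȳ)` of `F`, one has
`d(x_n, x̄) + d(y_n, ȳ) ≤ (kⁿ/(1−k))·[d(x₁,x₀) + d(y₁,y₀)]` for all `n ≥ 0`. -/
theorem coupled_fixed_point_error_estimate
    {X : Type*} [PartialOrder X] [MetricSpace X] [CompleteSpace X]
    (F : X → X → X) (hmm : MixedMonotone F)
    (k : ℝ) (hk0 : 0 ≤ k) (hk1 : k < 1)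
    (hcontr : ∀ x y u v : X, u ≤ x → y ≤ v →
      dist (F x y) (F u v) + dist (F y x) (F v u) ≤ k * (dist x u + dist y v))
    (x₀ y₀ : X) (hx₀ : x₀ ≤ F x₀ y₀) (hy₀ : F y₀ x₀ ≤ y₀)
    (x y : ℕ → X) (hx0 : x 0 = x₀) (hy0 : y 0 = y₀)
    (hx : ∀ n : ℕ, x (n + 1) = F (x n) (y n))
    (hy : ∀ n : ℕ, y (n + 1) = F (y n) (x n))
    (xbar ybar : X)
    (hxlim : Filter.Tendsto x Filter.atTop (nhds xbar))
    (hylim : Filter.Tendsto y Filter.atTop (nhds ybar))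
    (hxfix : F xbar ybar = xbar) (hyfix : F ybar xbar = ybar) :
    ∀ n : ℕ, dist (x n) xbar + dist (y n) ybar ≤
      k ^ n / (1 - k) * (dist (x 1) (x 0) + dist (y 1) (y 0)) := by
  have hmono : ∀ n : ℕ, x n ≤ x (n + 1) ∧ y (n + 1) ≤ y n := by
    intro n
    induction n with
    | zero =>
      rw [hx 0, hy 0, hx0, hy0]
      exact ⟨hx₀, hy₀⟩
    | succ n ih =>
      obtain ⟨h1, h2⟩ := ih
      rw [hx (n + 1), hy (n + 1)]
      constructor
      · calc x (n + 1) = F (x n) (y n) := hx n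
          _ ≤ F (x (n + 1)) (y n) := hmm.1 _ h1
          _ ≤ F (x (n + 1)) (y (n + 1)) := hmm.2 _ h2
      · calc F (y (n + 1)) (x (n + 1)) ≤ F (y n) (x (n + 1)) := hmm.1 _ h2
          _ ≤ F (y n) (x n) := hmm.2 _ h1
          _ = y (n + 1) := (hy n).symm
  set S : ℝ := dist (x 1) (x 0) + dist (y 1) (y 0) with hS
  have hS0 : 0 ≤ S := by positivity
  have hk : 0 < 1 - k := by linarith
  have hstep : ∀ n : ℕ, dist (x (n + 1)) (x n) + dist (y (n + 1)) (y n) ≤ k ^ n * S := by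
    intro n
    induction n with
    | zero => simp [hS]
    | succ n ih =>
      have h := hcontr (x (n + 1)) (y (n + 1)) (x n) (y n) (hmono n).1 (hmono n).2
      rw [← hx, ← hy, ← hx, ← hy] at h
      calc _ ≤ _ := h
        _ ≤ k * (k ^ n * S) := mul_le_mul_of_nonneg_left ih hk0
        _ = k ^ (n + 1) * S := by ring
  intro n
  have hsum : ∀ m : ℕ, dist (x n) (x (m + n)) + dist (y n) (y (m + n)) ≤
      (k ^ n - k ^ (m + n)) / (1 - k) * S := by
    intro m
    induction m with
    | zero => simp
    | succ m ih =>
      have h := hstep (m + n)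
      have e : m + 1 + n = m + n + 1 := by ring
      rw [e]
      have t1 := dist_triangle (x n) (x (m + n)) (x (m + n + 1))
      have t2 := dist_triangle (y n) (y (m + n)) (y (m + n + 1))
      rw [dist_comm (x (m + n + 1))] at h
      rw [dist_comm (y (m + n + 1))] at h
      have e2 : (k ^ n - k ^ (m + n + 1)) / (1 - k) * S =
          (k ^ n - k ^ (m + n)) / (1 - k) * S + k ^ (m + n) * S := by
        field_simp
        ring
      linarith
  have hlim : Filter.Tendsto (fun m : ℕ => dist (x n) (x (m + n)) + dist (y n) (y (m + n)))
      Filter.atTop (nhds (dist (x n) xbar + dist (y n) ybar)) :=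
    (tendsto_const_nhds.dist (hxlim.comp (Filter.tendsto_add_atTop_nat n))).add
      (tendsto_const_nhds.dist (hylim.comp (Filter.tendsto_add_atTop_nat n)))
  refine le_of_tendsto' hlim fun m => (hsum m).trans ?_
  have : 0 ≤ k ^ (m + n) := by positivity
  gcongr
  linarith
end
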